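/- For each n ≥ 2 let N_n be the number of words (x_1, …, x_n) ∈ {0,1}^n satisfying x_ℓ x_{2ℓ} = 0 for all ℓ ≥ 1 with 2ℓ ≤ n. Then the limit lim_{n→∞} (log₂ N_n)/n exists and equals ∑_{k=1}^{∞} (log₂ a_k)/2^{k+1}, where (a_k) is the Fibonacci-type sequence with a_0 = 1, a_1 = 2, a_k = a_{k-1} + a_{k-2} for k ≥ 2. Consequently, the box dimension of the set X_0 = {x ∈ {0,1}^ℕ : x_n x_{2n} = 0 for all n ≥ 1} (in the metric ρ(x,y) = 2^{-min{k : x_k ≠ y_k}}) equals (1/(2 log 2)) ∑_{n=1}^{∞} (log a_n)/2^n. -/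

import Mathlib

/-!
STATEMENT 15: With N_n the number of words (x_1,…,x_n) ∈ {0,1}^n such that
x_ℓ x_{2ℓ} = 0 whenever 2ℓ ≤ n, the limit lim (log₂ N_n)/n exists and equals
∑_{k=1}^∞ (log₂ a_k)/2^{k+1} (a_0 = 1, a_1 = 2, a_k = a_{k-1}+a_{k-2});
consequently, the box dimension of X_0 = {x ∈ {0,1}^ℕ : x_n x_{2n} = 0 ∀ n ≥ 1}
(in the metric 2^{-min{k : x_k ≠ y_k}}) equals (1/(2 log 2)) ∑_{n=1}^∞ (log a_n)/2^n.

{0,1}^ℕ is modelled as `ℕ → Bool` (`true ↦ 1`, `false ↦ 0`, `x i` representing the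
coordinate `x_{i+1}`), with the metric `dist x y = 2^{-min{i ≥ 0 : x_i ≠ y_i}}`
(`PiNat.metricSpace`). The box dimension statement is expressed via covering numbers:
`coverNum s ε` is the least number of open ε-balls needed to cover `s`, and the box
dimension is the limit of `log (coverNum X₀ ε) / log (1/ε)` as `ε → 0⁺`.
-/

open Filter

/-- The Fibonacci-type sequence a_0 = 1, a_1 = 2, a_k = a_{k-1} + a_{k-2}. -/
def fibA : ℕ → ℕ
  | 0 => 1
  | 1 => 2
  | (k + 2) => fibA (k + 1) + fibA k

/-- `wordCount n` = number of admissible words of length `n`. -/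
noncomputable def wordCount (n : ℕ) : ℕ :=
  Nat.card {x : Fin n → Bool //
    ∀ l : ℕ, ∀ (h1 : 1 ≤ l) (h2 : 2 * l ≤ n),
      x ⟨l - 1, by omega⟩ = false ∨ x ⟨2 * l - 1, by omega⟩ = false}

noncomputable instance : MetricSpace (ℕ → Bool) := PiNat.metricSpace

/-- The least cardinality of a cover of `s` by open balls of radius `ε`. -/
noncomputable def coverNum {X : Type*} [MetricSpace X] (s : Set X) (ε : ℝ) : ℕ :=
  sInf {m : ℕ | ∃ t : Finset X, t.card = m ∧ s ⊆ ⋃ x ∈ t, Metric.ball x ε}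

/-- The set X₀ = {x ∈ {0,1}^ℕ : x_n x_{2n} = 0 for all n ≥ 1}. -/
def X₀ : Set (ℕ → Bool) :=
  {x | ∀ n : ℕ, 1 ≤ n → (x (n - 1) = false ∨ x (2 * n - 1) = false)}

/-- A word with no two consecutive ones. -/
def IsSparse {k : ℕ} (c : Fin k → Bool) : Prop :=
  ∀ j : ℕ, ∀ h : j + 1 < k, c ⟨j, by omega⟩ = false ∨ c ⟨j + 1, h⟩ = false

/-- Deleting a leading zero is a bijection on words with no two consecutive ones. -/
def sparseConsFalseEquiv (k : ℕ) :
    {c : Fin (k + 1) → Bool // IsSparse c ∧ c 0 = false} ≃ {c : Fin k → Bool // IsSparse c} where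
  toFun c := ⟨Fin.tail c.1, fun j h => c.2.1 (j + 1) (by omega)⟩
  invFun c := ⟨Fin.cons false c.1, by
    refine ⟨fun j h => ?_, rfl⟩
    cases j with
    | zero => exact Or.inl rfl
    | succ j => exact c.2 j (by omega)⟩
  left_inv c := by
    ext1
    have h := Fin.cons_self_tail c.1
    rwa [c.2.2] at h
  right_inv c := by
    ext1
    exact Fin.tail_cons (α := fun _ => Bool) false c.1

/-- Deleting a leading one is a bijection onto the sparse words starting with a zero. -/
def sparseConsTrueEquiv (k : ℕ) :
    {c : Fin (k + 2) → Bool // IsSparse c ∧ ¬ c 0 = false} ≃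
      {c : Fin (k + 1) → Bool // IsSparse c ∧ c 0 = false} where
  toFun c := ⟨Fin.tail c.1, fun j h => c.2.1 (j + 1) (by omega),
    (c.2.1 0 (by omega)).resolve_left c.2.2⟩
  invFun c := ⟨Fin.cons true c.1, by
    refine ⟨fun j h => ?_, by simp⟩
    cases j with
    | zero => exact Or.inr c.2.2
    | succ j => exact c.2.1 j (by omega)⟩
  left_inv c := by
    ext1
    have h := Fin.cons_self_tail c.1
    rwa [Bool.eq_true_of_not_eq_false c.2.2] at h
  right_inv c := by
    ext1
    exact Fin.tail_cons (α := fun _ => Bool) true c.1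

lemma card_sparse (k : ℕ) : Nat.card {c : Fin k → Bool // IsSparse c} = fibA k := by
  induction k using Nat.twoStepInduction with
  | zero =>
    rw [Nat.card_congr (Equiv.subtypeUnivEquiv (p := IsSparse) fun c j h => absurd h (by omega))]
    simp [fibA]
  | one =>
    rw [Nat.card_congr (Equiv.subtypeUnivEquiv (p := IsSparse) fun c j h => absurd h (by omega))]
    simp [fibA]
  | more k ih₀ ih₁ =>
    classical
    have e := (Equiv.sumCompl
      (fun c : {c : Fin (k + 2) → Bool // IsSparse c} => c.1 0 = false)).symm
    rw [Nat.card_congr e, Nat.card_sum,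
      Nat.card_congr (Equiv.subtypeSubtypeEquivSubtypeInter _
        (fun c : Fin (k + 2) → Bool => c 0 = false)),
      Nat.card_congr (Equiv.subtypeSubtypeEquivSubtypeInter _
        (fun c : Fin (k + 2) → Bool => ¬ c 0 = false)),
      Nat.card_congr (sparseConsFalseEquiv (k + 1)), Nat.card_congr (sparseConsTrueEquiv k),
      Nat.card_congr (sparseConsFalseEquiv k), ih₀, ih₁, fibA]

lemma two_pow_mul_odd_injective {j j' k k' : ℕ}
    (h : 2 ^ j * (2 * k + 1) = 2 ^ j' * (2 * k' + 1)) : j = j' ∧ k = k' := by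
  induction j generalizing j' with
  | zero =>
    cases j' with
    | zero => omega
    | succ j' => rw [pow_succ', mul_assoc] at h; omega
  | succ j ih =>
    cases j' with
    | zero => rw [pow_succ', mul_assoc] at h; omega
    | succ j' =>
      rw [pow_succ', pow_succ', mul_assoc, mul_assoc] at h
      have := ih (Nat.eq_of_mul_eq_mul_left two_pos h)
      omega

lemma lt_size_div_odd_iff {n k j : ℕ} :
    j < (n / (2 * k + 1)).size ↔ 2 ^ j * (2 * k + 1) ≤ n := by
  rw [Nat.lt_size, Nat.le_div_iff_mul_le (by omega)]

/-- Positions up to `n` decomposed into the chains `2k+1, 2(2k+1), 4(2k+1), …`. -/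
noncomputable def chainEquiv (n : ℕ) :
    (Σ k : Fin n, Fin (n / (2 * k.1 + 1)).size) ≃ Fin n :=
  Equiv.ofBijective
    (fun p => ⟨2 ^ p.2.1 * (2 * p.1.1 + 1) - 1, by
      have := lt_size_div_odd_iff.1 p.2.2
      have : 0 < 2 ^ p.2.1 * (2 * p.1.1 + 1) := by positivity
      omega⟩) (by
    constructor
    · rintro ⟨⟨k, hk⟩, ⟨j, hj⟩⟩ ⟨⟨k', hk'⟩, ⟨j', hj'⟩⟩ h
      simp only [Fin.mk.injEq] at h
      have h1 : 0 < 2 ^ j * (2 * k + 1) := by positivity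
      have h2 : 0 < 2 ^ j' * (2 * k' + 1) := by positivity
      obtain ⟨rfl, rfl⟩ := two_pow_mul_odd_injective
        (show 2 ^ j * (2 * k + 1) = 2 ^ j' * (2 * k' + 1) by omega)
      rfl
    · rintro ⟨m, hm⟩
      obtain ⟨j, _, ⟨k, rfl⟩, hjk⟩ := Nat.exists_eq_two_pow_mul_odd (Nat.succ_ne_zero m)
      have h1 : 2 * k + 1 ≤ 2 ^ j * (2 * k + 1) := Nat.le_mul_of_pos_left _ (by positivity)
      refine ⟨⟨⟨k, by omega⟩, ⟨j, lt_size_div_odd_iff.2 (by simpa using hjk ▸ hm)⟩⟩, ?_⟩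
      simp only [Fin.mk.injEq]
      omega)

lemma chainEquiv_val {n : ℕ} (k : Fin n) (j : Fin (n / (2 * k.1 + 1)).size) :
    (chainEquiv n ⟨k, j⟩ : ℕ) = 2 ^ j.1 * (2 * k.1 + 1) - 1 := rfl

lemma admissible_iff_sparse_chains {n : ℕ} (x : Fin n → Bool) :
    (∀ l : ℕ, ∀ (_ : 1 ≤ l) (_ : 2 * l ≤ n),
      x ⟨l - 1, by omega⟩ = false ∨ x ⟨2 * l - 1, by omega⟩ = false) ↔
    ∀ k : Fin n, IsSparse fun j => x (chainEquiv n ⟨k, j⟩) := by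
  constructor
  · intro h k j hj
    have hj' := lt_size_div_odd_iff.1 hj
    rw [pow_succ', mul_assoc] at hj'
    convert h (2 ^ j * (2 * k + 1)) (Nat.one_le_iff_ne_zero.2 (by positivity)) hj' using 4
    all_goals simp only [chainEquiv_val, pow_succ', mul_assoc]
  · intro h l hl hln
    obtain ⟨j, _, ⟨k, rfl⟩, rfl⟩ := Nat.exists_eq_two_pow_mul_odd (show l ≠ 0 by omega)
    have h1 : 2 * k + 1 ≤ 2 ^ j * (2 * k + 1) := Nat.le_mul_of_pos_left _ (by positivity)
    convert h ⟨k, by omega⟩ j (lt_size_div_odd_iff.2 (by rwa [pow_succ', mul_assoc])) using 4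
    all_goals simp only [chainEquiv_val, pow_succ', mul_assoc]

lemma wordCount_eq_prod (n : ℕ) :
    wordCount n = ∏ k : Fin n, fibA (n / (2 * k.1 + 1)).size := by
  have e : {x : Fin n → Bool // ∀ k : Fin n, IsSparse fun j => x (chainEquiv n ⟨k, j⟩)} ≃
      {f : ∀ k : Fin n, Fin (n / (2 * k.1 + 1)).size → Bool // ∀ k, IsSparse (f k)} :=
    (((chainEquiv n).arrowCongr (Equiv.refl Bool)).symm.trans
      (Equiv.piCurry fun _ _ => Bool)).subtypeEquiv fun x => Iff.rfl
  rw [wordCount, Nat.card_congr (Equiv.subtypeEquivRight admissible_iff_sparse_chains),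
    Nat.card_congr e, Nat.card_congr Equiv.subtypePiEquivPi, Nat.card_pi]
  exact Finset.prod_congr rfl fun k _ => card_sparse _

lemma fibA_pos (k : ℕ) : 0 < fibA k := by
  induction k using Nat.twoStepInduction with
  | zero => simp [fibA]
  | one => simp [fibA]
  | more k h₀ h₁ => rw [fibA]; omega

lemma fibA_le_succ (k : ℕ) : fibA k ≤ fibA (k + 1) := by
  cases k with
  | zero => simp [fibA]
  | succ k => rw [fibA]; omega

lemma fibA_succ_le (k : ℕ) : fibA (k + 1) ≤ 2 * fibA k := by
  cases k with
  | zero => simp [fibA]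
  | succ k => have := fibA_le_succ k; rw [fibA]; omega

/-- The increments of `log₂ a_k`. -/
noncomputable def fibIncr (j : ℕ) : ℝ := Real.logb 2 (fibA (j + 1)) - Real.logb 2 (fibA j)

lemma fibIncr_nonneg (j : ℕ) : 0 ≤ fibIncr j := by
  have h : (0 : ℝ) < fibA j := by exact_mod_cast fibA_pos j
  exact sub_nonneg.2 (Real.logb_le_logb_of_le one_lt_two h (by exact_mod_cast fibA_le_succ j))

lemma fibIncr_le_one (j : ℕ) : fibIncr j ≤ 1 := by
  have h : (0 : ℝ) < fibA j := by exact_mod_cast fibA_pos j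
  have h' : (0 : ℝ) < fibA (j + 1) := by exact_mod_cast fibA_pos (j + 1)
  have := Real.logb_le_logb_of_le one_lt_two h'
    (show (fibA (j + 1) : ℝ) ≤ 2 * fibA j by exact_mod_cast fibA_succ_le j)
  rw [Real.logb_mul two_ne_zero h.ne', Real.logb_self_eq_one one_lt_two] at this
  rw [fibIncr]
  linarith

lemma logb_fibA_eq_sum (k : ℕ) : Real.logb 2 (fibA k) = ∑ j ∈ Finset.range k, fibIncr j := by
  simp [fibIncr, Finset.sum_range_sub (fun j => Real.logb 2 (fibA j)), fibA]

lemma logb_fibA_le (k : ℕ) : Real.logb 2 (fibA k) ≤ k := by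
  rw [logb_fibA_eq_sum]
  simpa using Finset.sum_le_sum fun j (_ : j ∈ Finset.range k) => fibIncr_le_one j

lemma logb_fibA_nonneg (k : ℕ) : 0 ≤ Real.logb 2 (fibA k) :=
  Real.logb_nonneg one_lt_two (by exact_mod_cast fibA_pos k)

lemma logb_wordCount (n : ℕ) :
    Real.logb 2 (wordCount n) = ∑' j : ℕ, fibIncr j * ((n / 2 ^ j + 1) / 2 : ℕ) := by
  have hlt : ∀ j, n ≤ j → n < 2 ^ j := fun j h => h.trans_lt Nat.lt_two_pow_self
  rw [tsum_eq_sum (s := Finset.range n) fun j hj => by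
      rw [Nat.div_eq_of_lt (hlt j (by simpa using hj))]; simp,
    wordCount_eq_prod, Nat.cast_prod,
    Real.logb_prod _ _ fun k _ => by exact_mod_cast (fibA_pos _).ne',
    Fin.sum_univ_eq_sum_range (fun k => Real.logb 2 (fibA (n / (2 * k + 1)).size)) n]
  have hchain : ∀ k, Real.logb 2 (fibA (n / (2 * k + 1)).size) =
      ∑ j ∈ Finset.range n, if 2 ^ j * (2 * k + 1) ≤ n then fibIncr j else 0 := by
    intro k
    rw [logb_fibA_eq_sum, ← Finset.sum_filter]
    refine Finset.sum_congr (Finset.ext fun j => ?_) fun _ _ => rfl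
    rw [Finset.mem_range, Finset.mem_filter, Finset.mem_range, lt_size_div_odd_iff]
    refine ⟨fun h => ⟨?_, h⟩, fun h => h.2⟩
    by_contra! hj
    have := Nat.le_mul_of_pos_right (2 ^ j) (show 0 < 2 * k + 1 by omega)
    have := hlt j hj
    omega
  simp_rw [hchain]
  rw [Finset.sum_comm]
  refine Finset.sum_congr rfl fun j _ => ?_
  have hcount : (Finset.range n).filter (fun k => 2 ^ j * (2 * k + 1) ≤ n) =
      Finset.range ((n / 2 ^ j + 1) / 2) := by
    ext k
    have h1 : 2 ^ j * (2 * k + 1) ≤ n ↔ 2 * k + 1 ≤ n / 2 ^ j := by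
      rw [Nat.le_div_iff_mul_le (by positivity), mul_comm]
    have h2 : n / 2 ^ j ≤ n := Nat.div_le_self _ _
    rw [Finset.mem_filter, Finset.mem_range, Finset.mem_range, h1]
    omega
  rw [← Finset.sum_filter, hcount, Finset.sum_const, Finset.card_range, nsmul_eq_mul, mul_comm]

lemma tendsto_oddCount_div (j : ℕ) :
    Tendsto (fun n : ℕ => (((n / 2 ^ j + 1) / 2 : ℕ) : ℝ) / n) atTop
      (nhds (1 / 2 ^ (j + 1))) := by
  have h0 : Tendsto (fun n : ℕ => (1 : ℝ) / n) atTop (nhds 0) :=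
    tendsto_one_div_atTop_nhds_zero_nat
  have hl : Tendsto (fun n : ℕ => (1 : ℝ) / 2 ^ (j + 1) - 1 / n) atTop
      (nhds (1 / 2 ^ (j + 1))) := by simpa using h0.const_sub ((1 : ℝ) / 2 ^ (j + 1))
  have hu : Tendsto (fun n : ℕ => (1 : ℝ) / 2 ^ (j + 1) + 1 / n) atTop
      (nhds (1 / 2 ^ (j + 1))) := by simpa using h0.const_add ((1 : ℝ) / 2 ^ (j + 1))
  refine tendsto_of_tendsto_of_tendsto_of_le_of_le' hl hu ?_ ?_ <;>
    filter_upwards [eventually_gt_atTop 0] with n hn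
  all_goals
    have hn' : (0 : ℝ) < n := by exact_mod_cast hn
    have hp : (0 : ℝ) < 2 ^ j := by positivity
    have hd : ((n / 2 ^ j : ℕ) : ℝ) ≤ n / 2 ^ j := by exact_mod_cast Nat.cast_div_le (α := ℝ)
    have hd' : (n : ℝ) / 2 ^ j < (n / 2 ^ j : ℕ) + 1 := by
      rw [div_lt_iff₀ hp]
      exact_mod_cast Nat.lt_mul_of_div_lt (Nat.lt_succ_self (n / 2 ^ j)) (by positivity)
    have hm : 2 * (((n / 2 ^ j + 1) / 2 : ℕ) : ℝ) ≤ (n / 2 ^ j : ℕ) + 1 := by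
      exact_mod_cast Nat.mul_div_le _ 2
    have hm' : ((n / 2 ^ j : ℕ) : ℝ) ≤ 2 * (((n / 2 ^ j + 1) / 2 : ℕ) : ℝ) := by
      exact_mod_cast (by omega : n / 2 ^ j ≤ 2 * ((n / 2 ^ j + 1) / 2))
    have he : (1 : ℝ) / 2 ^ (j + 1) = n / 2 ^ j / 2 / n := by
      rw [pow_succ]; field_simp
    rw [he]
  · rw [← sub_div]; gcongr; linarith
  · rw [← add_div]; gcongr; linarith

lemma summable_two_inv_pow : Summable fun j : ℕ => (1 : ℝ) / 2 ^ j := by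
  simpa using summable_geometric_two

lemma tendsto_logb_wordCount_div :
    Tendsto (fun n : ℕ => Real.logb 2 (wordCount n) / n) atTop
      (nhds (∑' j : ℕ, fibIncr j / 2 ^ (j + 1))) := by
  have h : (fun n : ℕ => Real.logb 2 (wordCount n) / n) =
      fun n : ℕ => ∑' j : ℕ, fibIncr j * ((((n / 2 ^ j + 1) / 2 : ℕ) : ℝ) / n) := by
    ext n
    rw [logb_wordCount, ← tsum_div_const]
    simp_rw [mul_div_assoc]
  rw [h]
  refine tendsto_tsum_of_dominated_convergence summable_two_inv_pow (fun j => ?_)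
    (Eventually.of_forall fun n j => ?_)
  · simpa [div_eq_mul_inv] using (tendsto_oddCount_div j).const_mul (fibIncr j)
  · have hc := fibIncr_nonneg j
    have hq : (((n / 2 ^ j + 1) / 2 : ℕ) : ℝ) / n ≤ 1 / 2 ^ j := by
      have h1 : (((n / 2 ^ j + 1) / 2 : ℕ) : ℝ) ≤ (n : ℝ) / 2 ^ j := by
        calc (((n / 2 ^ j + 1) / 2 : ℕ) : ℝ) ≤ (n / 2 ^ j : ℕ) := by
              generalize n / 2 ^ j = q
              exact_mod_cast (by omega : (q + 1) / 2 ≤ q)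
          _ ≤ n / 2 ^ j := by exact_mod_cast Nat.cast_div_le (α := ℝ)
      rcases n.eq_zero_or_pos with rfl | hn
      · simp
      · rw [div_le_iff₀ (by exact_mod_cast hn)]
        linarith [show (1 : ℝ) / 2 ^ j * n = n / 2 ^ j by ring]
    rw [Real.norm_of_nonneg (by positivity)]
    calc fibIncr j * _ ≤ 1 * (1 / 2 ^ j) :=
          mul_le_mul (fibIncr_le_one j) hq (by positivity) zero_le_one
      _ = _ := one_mul _

lemma summable_logb_fibA : Summable fun k : ℕ => Real.logb 2 (fibA k) / 2 ^ (k + 1) := by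
  have h : Summable fun k : ℕ => (k : ℝ) * (1 / 2) ^ k := by
    simpa using summable_pow_mul_geometric_of_norm_lt_one 1
      (show ‖(1 / 2 : ℝ)‖ < 1 by norm_num)
  refine Summable.of_nonneg_of_le (fun k => div_nonneg (logb_fibA_nonneg k) (by positivity))
    (fun k => ?_) h
  rw [one_div, inv_pow, ← div_eq_mul_inv]
  exact div_le_div₀ (by positivity) (logb_fibA_le k) (by positivity)
    (pow_le_pow_right₀ one_le_two (Nat.le_succ k))

lemma tsum_fibIncr :
    ∑' j : ℕ, fibIncr j / 2 ^ (j + 1) = ∑' k : ℕ, Real.logb 2 (fibA (k + 1)) / 2 ^ (k + 2) := by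
  have hs := summable_logb_fibA
  have hs' := (summable_nat_add_iff 1).2 hs
  have h0 := hs.tsum_eq_zero_add
  have hterm : ∀ j : ℕ, fibIncr j / 2 ^ (j + 1) =
      2 * (Real.logb 2 (fibA (j + 1)) / 2 ^ (j + 1 + 1)) -
        Real.logb 2 (fibA j) / 2 ^ (j + 1) := by
    intro j
    rw [fibIncr, pow_succ _ (j + 1)]
    field_simp
  simp_rw [hterm]
  rw [(hs'.mul_left 2).tsum_sub hs, tsum_mul_left, h0]
  simp only [fibA, Nat.cast_one, Real.logb_one, zero_div, zero_add]
  ring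

lemma tsum_logb_fibA_eq :
    (∑' k : ℕ, Real.logb 2 (fibA (k + 1)) / 2 ^ (k + 2))
      = (1 / (2 * Real.log 2)) * ∑' k : ℕ, Real.log (fibA (k + 1)) / 2 ^ (k + 1) := by
  rw [← tsum_mul_left]
  refine tsum_congr fun k => ?_
  rw [Real.logb, pow_succ _ (k + 1)]
  field_simp

/-- The extension of a finite word by zeros. -/
def extendZero {n : ℕ} (w : Fin n → Bool) (i : ℕ) : Bool :=
  if h : i < n then w ⟨i, h⟩ else false

lemma PiNat.dist_lt_iff_agree {ε : ℝ} {m : ℕ} (hm : (1 / 2 : ℝ) ^ m < ε)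
    (hm' : ∀ k < m, ε ≤ (1 / 2 : ℝ) ^ k) (x y : ℕ → Bool) :
    dist x y < ε ↔ ∀ i < m, x i = y i := by
  rcases eq_or_ne x y with rfl | hne
  · simpa using lt_trans (by positivity) hm
  have hd : dist x y = (1 / 2 : ℝ) ^ PiNat.firstDiff x y := PiNat.dist_eq_of_ne hne
  rw [hd]
  constructor
  · intro h i hi
    refine PiNat.apply_eq_of_lt_firstDiff (lt_of_lt_of_le hi ?_)
    by_contra! hlt
    exact (hm' _ hlt).not_gt h
  · intro h
    refine lt_of_le_of_lt (pow_le_pow_of_le_one (by norm_num) (by norm_num) ?_) hm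
    by_contra! hlt
    exact PiNat.apply_firstDiff_ne hne (h _ hlt)

lemma coverNum_X₀_eq {ε : ℝ} {m : ℕ} (hm : (1 / 2 : ℝ) ^ m < ε)
    (hm' : ∀ k < m, ε ≤ (1 / 2 : ℝ) ^ k) : coverNum X₀ ε = wordCount m := by
  classical
  have hball := PiNat.dist_lt_iff_agree hm hm'
  set W := {x : Fin m → Bool // ∀ l : ℕ, ∀ (h1 : 1 ≤ l) (h2 : 2 * l ≤ m),
      x ⟨l - 1, by omega⟩ = false ∨ x ⟨2 * l - 1, by omega⟩ = false}
  have hinj : Function.Injective fun w : W => extendZero w.1 := by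
    intro w w' h
    refine Subtype.ext (funext fun i => ?_)
    simpa [extendZero] using congrFun h i.1
  have hcard : wordCount m = Fintype.card W := by rw [wordCount, Nat.card_eq_fintype_card]
  have hext : ∀ w : W, extendZero w.1 ∈ X₀ := by
    intro w n hn
    by_cases h : 2 * n ≤ m
    · simpa [extendZero, show n - 1 < m by omega, show 2 * n - 1 < m by omega] using w.2 n hn h
    · exact Or.inr (dif_neg (by omega))
  rw [coverNum]
  refine le_antisymm (Nat.sInf_le ?_) (le_csInf ?_ ?_)
  all_goals
    have hcover : ∃ t : Finset (ℕ → Bool), t.card = wordCount m ∧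
        X₀ ⊆ ⋃ x ∈ t, Metric.ball x ε := by
      refine ⟨Finset.univ.image fun w : W => extendZero w.1, ?_, fun x hx => ?_⟩
      · rw [Finset.card_image_of_injective _ hinj, hcard, Finset.card_univ]
      · let w : W := ⟨fun i => x i, fun l h1 _ => hx l h1⟩
        refine Set.mem_biUnion (x := extendZero w.1) (by simp) ?_
        rw [Metric.mem_ball, hball]
        intro i hi
        simp [extendZero, hi, w]
  · exact hcover
  · exact ⟨_, hcover⟩
  · rintro _ ⟨t, rfl, ht⟩
    have hc : ∀ w : W, ∃ y ∈ t, ∀ i < m, extendZero w.1 i = y i := by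
      intro w
      obtain ⟨y, hy, hd⟩ := Set.mem_iUnion₂.1 (ht (hext w))
      exact ⟨y, hy, (hball _ _).1 hd⟩
    choose f hf hfm using hc
    rw [hcard, ← Finset.card_univ]
    refine Finset.card_le_card_of_injOn f (fun w _ => hf w) fun w _ w' _ h => ?_
    refine Subtype.ext (funext fun i => ?_)
    have h1 := hfm w i i.2
    have h2 := hfm w' i i.2
    rw [h, ← h2] at h1
    simpa [extendZero] using h1

lemma tendsto_log_coverNum {L : ℝ}
    (hL : Tendsto (fun n : ℕ => Real.logb 2 (wordCount n) / n) atTop (nhds L)) :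
    Tendsto (fun ε : ℝ => Real.log (coverNum X₀ ε) / Real.log (1 / ε))
      (nhdsWithin 0 (Set.Ioi 0)) (nhds L) := by
  have hlog2 : 0 < Real.log 2 := Real.log_pos one_lt_two
  let g : ℝ → ℝ := fun ε => Real.logb 2 (1 / ε)
  have hg : Tendsto g (nhdsWithin 0 (Set.Ioi 0)) atTop := by
    simp only [g, one_div]
    exact (Real.tendsto_logb_atTop one_lt_two).comp tendsto_inv_nhdsGT_zero
  let M : ℝ → ℕ := fun ε => ⌊g ε⌋₊ + 1
  have hM : Tendsto M (nhdsWithin 0 (Set.Ioi 0)) atTop :=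
    (tendsto_add_atTop_nat 1).comp (tendsto_nat_floor_atTop.comp hg)
  have hratio : Tendsto (fun ε => (M ε : ℝ) / g ε) (nhdsWithin 0 (Set.Ioi 0)) (nhds 1) := by
    have h1 := (tendsto_nat_floor_div_atTop (R := ℝ)).comp hg
    have h2 := h1.add (tendsto_inv_atTop_zero.comp hg)
    rw [add_zero] at h2
    refine h2.congr fun ε => ?_
    simp [M, Function.comp, add_div]
  have hmain := (hL.comp hM).mul hratio
  rw [mul_one] at hmain
  refine hmain.congr' ?_
  filter_upwards [hg.eventually_gt_atTop 0, self_mem_nhdsWithin] with ε hgε hε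
  have hε : 0 < ε := hε
  have hpow : ∀ k : ℕ, (1 / 2 : ℝ) ^ k < ε ↔ g ε < k := by
    intro k
    rw [Real.logb_lt_iff_lt_rpow one_lt_two (by positivity), Real.rpow_natCast, one_div_pow,
      one_div_lt (by positivity) hε]
  have hcov : coverNum X₀ ε = wordCount (M ε) := by
    refine coverNum_X₀_eq ((hpow _).2 ?_) fun k hk => not_lt.1 fun h => ?_
    · simpa [M] using Nat.lt_floor_add_one (g ε)
    · have h1 := (hpow k).1 h
      have h2 := (Nat.floor_lt hgε.le).2 h1
      exact absurd hk (not_lt.2 h2)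
  have hM0 : (M ε : ℝ) ≠ 0 := by simp [M, Nat.cast_add_one_ne_zero]
  have hlog : Real.log (1 / ε) = g ε * Real.log 2 := by
    simp only [g, Real.logb]; field_simp
  rw [hcov, hlog]
  simp only [Function.comp, Real.logb]
  field_simp

theorem boxDim_X₀ :
    Tendsto (fun n : ℕ => Real.logb 2 (wordCount n) / n) atTop
        (nhds (∑' k : ℕ, Real.logb 2 (fibA (k + 1)) / 2 ^ (k + 2))) ∧
      (∑' k : ℕ, Real.logb 2 (fibA (k + 1)) / 2 ^ (k + 2))
        = (1 / (2 * Real.log 2)) * ∑' k : ℕ, Real.log (fibA (k + 1)) / 2 ^ (k + 1) ∧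
      Tendsto (fun ε : ℝ => Real.log (coverNum X₀ ε) / Real.log (1 / ε))
        (nhdsWithin 0 (Set.Ioi 0))
        (nhds ((1 / (2 * Real.log 2)) * ∑' k : ℕ, Real.log (fibA (k + 1)) / 2 ^ (k + 1))) := by
  refine ⟨tsum_fibIncr ▸ tendsto_logb_wordCount_div, tsum_logb_fibA_eq, ?_⟩
  rw [← tsum_logb_fibA_eq, ← tsum_fibIncr]
  exact tendsto_log_coverNum tendsto_logb_wordCount_div
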